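/- arXiv:1610.08454 — 2 statements merged into one kernel-verified Lean document; each statement's English description precedes it below -/
import Mathlib

section
/- Let K be a nonarchimedean local field of characteristic 0 (equivalently, a finite extension of ℚ_p for some prime p), fix an algebraic closure Ω of K, and let k ∈ ℕ. Then the set of intermediate fields L with K ⊆ L ⊆ Ω and [L : K] ≤ k is finite. In particular, K has only finitely many totally ramified extensions of degree ≤ k inside Ω. -/
open Polynomial IntermediateField

namespace PadicAlgCl

variable {p : ℕ} [Fact p.Prime]

/-- An element has norm at most one if and only if the coefficients of its minimal polynomial have
norm at most one. -/
theorem norm_le_one_iff_norm_coeff_minpoly_le_one (x : PadicAlgCl p) :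
    ‖x‖ ≤ 1 ↔ ∀ i, ‖(minpoly ℚ_[p] x).coeff i‖ ≤ 1 :=
  spectralValue_le_one_iff (minpoly.monic (Algebra.IsIntegral.isIntegral x))

theorem isIntegral_iff_norm_le_one {L : IntermediateField ℚ_[p] (PadicAlgCl p)} (x : L) :
    IsIntegral ℤ_[p] x ↔ ‖(x : PadicAlgCl p)‖ ≤ 1 := by
  rw [norm_le_one_iff_norm_coeff_minpoly_le_one, ← IntermediateField.minpoly_eq]
  refine ⟨fun h i ↦ ?_, fun h ↦ ?_⟩
  · rw [minpoly.isIntegrallyClosed_eq_field_fractions' ℚ_[p] h, coeff_map]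
    exact PadicInt.norm_le_one _
  · have hx : IsIntegral ℚ_[p] x := by
      rw [← isIntegral_algebraMap_iff (B := PadicAlgCl p) (algebraMap L _).injective]
      exact Algebra.IsIntegral.isIntegral _
    have hl : minpoly ℚ_[p] x ∈ lifts (algebraMap ℤ_[p] ℚ_[p]) :=
      (lifts_iff_coeff_lifts _).2 fun n ↦ ⟨⟨_, h n⟩, rfl⟩
    obtain ⟨q, hq, -, hm⟩ := lifts_and_degree_eq_and_monic hl (minpoly.monic hx)
    refine ⟨q, hm, ?_⟩
    rw [← aeval_def, ← aeval_map_algebraMap ℚ_[p], hq, minpoly.aeval]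

/-- If `[F : ℚ_p] < [L : ℚ_p]` then some element of the unit ball of `L` has distance at least
`‖p‖` from `F`. -/
theorem exists_norm_p_le_norm_sub (L F : IntermediateField ℚ_[p] (PadicAlgCl p))
    [FiniteDimensional ℚ_[p] L] [FiniteDimensional ℚ_[p] F]
    (h : Module.finrank ℚ_[p] F < Module.finrank ℚ_[p] L) :
    ∃ x ∈ L, ‖x‖ ≤ 1 ∧ ∀ y ∈ F, ‖(p : PadicAlgCl p)‖ ≤ ‖x - y‖ := by
  by_contra! H
  have hp0 : (p : ℚ_[p]) ≠ 0 := by exact_mod_cast (Fact.out : p.Prime).ne_zero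
  have hpL : (p : PadicAlgCl p) ≠ 0 := by exact_mod_cast (Fact.out : p.Prime).ne_zero
  have : Module.Finite ℤ_[p] (integralClosure ℤ_[p] L) := IsIntegralClosure.finite _ ℚ_[p] L _
  have : Module.IsTorsionFree ℤ_[p] L := Module.IsTorsionFree.trans_faithfulSMul ℤ_[p] ℚ_[p] L
  have : Module.Free ℤ_[p] (integralClosure ℤ_[p] L) :=
    IsIntegralClosure.module_free _ ℚ_[p] L _
  let b := Module.Free.chooseBasis ℤ_[p] (integralClosure ℤ_[p] L)
  have hcard := Module.finrank_eq_card_basis b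
  rw [IsIntegralClosure.rank ℤ_[p] ℚ_[p] L] at hcard
  choose y hyF hy using fun i ↦ H _ (b i : L).2 ((isIntegral_iff_norm_le_one _).1 (b i).2)
  have hdep : ¬ LinearIndependent ℚ_[p] (fun i ↦ (⟨y i, hyF i⟩ : F)) := fun hl ↦ by
    have := hl.fintype_card_le_finrank
    omega
  obtain ⟨g, hg, i, hi⟩ := Fintype.not_linearIndependent_iff.1 hdep
  have : Nonempty (Module.Free.ChooseBasisIndex ℤ_[p] (integralClosure ℤ_[p] L)) := ⟨i⟩
  obtain ⟨i₀, hi₀⟩ := Finite.exists_max fun i ↦ ‖g i‖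
  have hg₀ : 0 < ‖g i₀‖ := (norm_pos_iff.2 hi).trans_le (hi₀ i)
  let c (i) : ℤ_[p] := ⟨g i / g i₀, by rw [norm_div]; exact div_le_one_of_le₀ (hi₀ i) hg₀.le⟩
  have hc₀ : c i₀ = 1 := Subtype.ext (div_self (norm_pos_iff.1 hg₀))
  have hcy : ∑ i, (c i : ℚ_[p]) • y i = 0 := by
    have hg' : ∑ i, g i • y i = 0 := by simpa using congrArg (F.val) hg
    have : ∑ i, (c i : ℚ_[p]) • y i = (g i₀)⁻¹ • ∑ i, g i • y i := by
      rw [Finset.smul_sum]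
      refine Finset.sum_congr rfl fun i _ ↦ ?_
      rw [smul_smul, inv_mul_eq_div]
    rw [this, hg', smul_zero]
  let z := ∑ i, c i • b i
  have hz : ((z : L) : PadicAlgCl p) = ∑ i, (c i : ℚ_[p]) • ((b i : L) - y i) := by
    have h1 : ((z : L) : PadicAlgCl p) = ∑ i, (c i : ℚ_[p]) • ((b i : L) : PadicAlgCl p) := by
      simp only [z, AddSubmonoidClass.coe_finsetSum, Subalgebra.coe_smul]
      rfl
    simp only [smul_sub, Finset.sum_sub_distrib, hcy, sub_zero, h1]
  have hzlt : ‖((z : L) : PadicAlgCl p)‖ < ‖(p : PadicAlgCl p)‖ := by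
    obtain ⟨j, -, hj⟩ := IsUltrametricDist.exists_norm_finsetSum_le Finset.univ
      fun i ↦ (c i : ℚ_[p]) • (((b i : L) : PadicAlgCl p) - y i)
    rw [hz]
    refine hj.trans_lt (lt_of_le_of_lt ?_ (hy j))
    rw [norm_smul]
    exact mul_le_of_le_one_left (norm_nonneg _) (c j).2
  have hw : IsIntegral ℤ_[p] ((z : L) / (p : L)) := by
    rw [isIntegral_iff_norm_le_one]
    push_cast
    rw [norm_div]
    exact div_le_one_of_le₀ hzlt.le (norm_nonneg _)
  let w : integralClosure ℤ_[p] L := ⟨_, hw⟩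
  have hpw : (p : ℤ_[p]) • w = z := by
    have hpL' : (p : L) ≠ 0 := by exact_mod_cast (Fact.out : p.Prime).ne_zero
    refine Subtype.ext ?_
    rw [Subalgebra.coe_smul, Algebra.smul_def, map_natCast]
    exact mul_div_cancel₀ _ hpL'
  have h1 : (p : ℤ_[p]) * b.repr w i₀ = 1 := by
    rw [← hc₀, ← congrFun (b.repr_sum_self c) i₀, ← smul_eq_mul, ← Finsupp.smul_apply,
      ← map_smul, hpw]
  exact PadicInt.prime_p.not_isUnit (IsUnit.of_mul_eq_one _ h1)

open scoped Pointwise in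
/-- Finitely many fields of degree less than `n` stay uniformly away from a suitable element of the
unit ball of any field of degree `n`. -/
theorem exists_pos_forall_exists_le_norm_sub (n : ℕ)
    {S : Set (IntermediateField ℚ_[p] (PadicAlgCl p))} (hS : S.Finite)
    (hSn : ∀ F ∈ S, FiniteDimensional ℚ_[p] F ∧ Module.finrank ℚ_[p] F < n) :
    ∃ δ > 0, ∀ L : IntermediateField ℚ_[p] (PadicAlgCl p), FiniteDimensional ℚ_[p] L →
      Module.finrank ℚ_[p] L = n →
      ∃ x ∈ L, ‖x‖ ≤ 1 ∧ ∀ F ∈ S, ∀ y ∈ F, δ ≤ ‖x - y‖ := by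
  lift S to Finset (IntermediateField ℚ_[p] (PadicAlgCl p)) using hS
  let N : PadicAlgCl p := (S.card.factorial : PadicAlgCl p)
  have hN : N ≠ 0 := Nat.cast_ne_zero.2 S.card.factorial_ne_zero
  have hp : (p : PadicAlgCl p) ≠ 0 := Nat.cast_ne_zero.2 (Fact.out : p.Prime).ne_zero
  refine ⟨‖N‖ * ‖(p : PadicAlgCl p)‖, by positivity, fun L _ hL ↦ ?_⟩
  by_contra! H
  let B : AddSubgroup (PadicAlgCl p) :=
    { carrier := {x | x ∈ L ∧ ‖x‖ ≤ 1}
      zero_mem' := ⟨zero_mem _, by simp⟩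
      add_mem' := fun hx hy ↦ ⟨add_mem hx.1 hy.1,
        (IsUltrametricDist.norm_add_le_max _ _).trans (max_le hx.2 hy.2)⟩
      neg_mem' := fun hx ↦ ⟨neg_mem hx.1, by rw [norm_neg]; exact hx.2⟩ }
  let U (F : IntermediateField ℚ_[p] (PadicAlgCl p)) : AddSubgroup B :=
    { carrier := {x | ∃ y ∈ F, ‖(x : PadicAlgCl p) - y‖ < ‖N‖ * ‖(p : PadicAlgCl p)‖}
      zero_mem' := ⟨0, zero_mem _, by simp; positivity⟩
      add_mem' := by
        rintro a b ⟨y, hy, hya⟩ ⟨z, hz, hzb⟩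
        refine ⟨y + z, add_mem hy hz, ?_⟩
        rw [AddSubgroup.coe_add, add_sub_add_comm]
        exact (IsUltrametricDist.norm_add_le_max _ _).trans_lt (max_lt hya hzb)
      neg_mem' := by
        rintro a ⟨y, hy, hya⟩
        refine ⟨-y, neg_mem hy, ?_⟩
        rwa [AddSubgroup.coe_neg, ← neg_sub', norm_neg] }
  have hcov : ⋃ F ∈ S, (0 : B) +ᵥ (U F : Set B) = Set.univ := by
    refine Set.eq_univ_of_forall fun x ↦ ?_
    obtain ⟨F, hF, y, hy, hxy⟩ := H x x.2.1 x.2.2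
    simp only [zero_vadd, Set.mem_iUnion]
    exact ⟨F, hF, y, hy, hxy⟩
  obtain ⟨F, hF, hfin, hle⟩ := AddSubgroup.exists_index_le_card_of_leftCoset_cover hcov
  obtain ⟨_, hFn⟩ := hSn F hF
  obtain ⟨x, hxL, hx1, hx⟩ := exists_norm_p_le_norm_sub L F (hL ▸ hFn)
  have hmem : S.card.factorial • (⟨x, hxL, hx1⟩ : B) ∈ U F := by
    obtain ⟨t, ht⟩ := Nat.dvd_factorial (Nat.pos_of_ne_zero hfin.index_ne_zero) hle
    rw [ht, mul_comm, mul_nsmul']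
    exact nsmul_mem ((U F).nsmul_index_mem _) _
  obtain ⟨y, hy, hxy⟩ := hmem
  have hsub : ((S.card.factorial • (⟨x, hxL, hx1⟩ : B) : B) : PadicAlgCl p) - y =
      N * (x - y / N) := by
    rw [mul_sub, mul_div_cancel₀ _ hN, AddSubgroup.coe_nsmul, nsmul_eq_mul]
  rw [hsub, norm_mul] at hxy
  exact (lt_of_mul_lt_mul_left hxy (norm_nonneg _)).not_ge
    (hx _ (div_mem hy (_root_.natCast_mem F _)))

/-- If distinct roots of `f` have distance at least `η`, then an element at distance less than `η`
from a root `b` of `f` generates a field containing `b`. -/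
theorem adjoin_le_adjoin_of_norm_sub_lt {f : ℚ_[p][X]} {η : ℝ} (hf : f ≠ 0)
    (hη : ∀ b ∈ f.rootSet (PadicAlgCl p), ∀ b' ∈ f.rootSet (PadicAlgCl p), b ≠ b' → η ≤ ‖b - b'‖)
    {a b : PadicAlgCl p} (hb : b ∈ f.rootSet (PadicAlgCl p)) (hab : ‖a - b‖ < η) :
    ℚ_[p]⟮b⟯ ≤ ℚ_[p]⟮a⟯ := by
  rw [adjoin_simple_le_iff]
  have hbi : IsIntegral ℚ_[p] b := Algebra.IsIntegral.isIntegral b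
  refine IsKrasner.krasner (minpoly.irreducible hbi).separable (IsAlgClosed.splits _)
    (Algebra.IsIntegral.isIntegral a) fun b' hb' hne ↦ ?_
  rw [norm_sub_rev]
  refine hab.trans_le (hη b hb b' ?_ hne)
  rw [isConjRoot_iff_mem_minpoly_rootSet hbi] at hb'
  rw [mem_rootSet] at hb hb' ⊢
  exact ⟨hf, aeval_eq_zero_of_dvd_aeval_eq_zero (minpoly.dvd _ _ hb.2) hb'.2⟩

/-- Among the fields of degree `n`, only finitely many contain an element of the unit ball that has
a minimal polynomial of degree `n` close to `f` and stays at distance at least `δ` from all elements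
of degree less than `n`. -/
theorem exists_pos_finite_of_norm_coeff_sub_lt {n : ℕ} (hn : 0 < n) {δ : ℝ} (hδ : 0 < δ)
    {f : ℚ_[p][X]} (hf : f.Monic) (hfn : f.natDegree = n) :
    ∃ ε > 0, {L : IntermediateField ℚ_[p] (PadicAlgCl p) | FiniteDimensional ℚ_[p] L ∧
      Module.finrank ℚ_[p] L = n ∧ ∃ x ∈ L, ‖x‖ ≤ 1 ∧
      (∀ b : PadicAlgCl p, Module.finrank ℚ_[p] ℚ_[p]⟮b⟯ < n → δ ≤ ‖x - b‖) ∧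
      (minpoly ℚ_[p] x).natDegree = n ∧
      ∀ i, ‖f.coeff i - (minpoly ℚ_[p] x).coeff i‖ < ε}.Finite := by
  classical
  let R := f.rootSet (PadicAlgCl p)
  have hR : R.Finite := rootSet_finite f _
  obtain ⟨η, hη, hηδ, hηR⟩ : ∃ η > 0, η ≤ δ ∧ ∀ b ∈ R, ∀ b' ∈ R, b ≠ b' → η ≤ ‖b - b'‖ := by
    let D : Set ℝ := insert δ ((fun q ↦ ‖q.1 - q.2‖) '' (R ×ˢ R \ {q | q.1 = q.2}))
    have hD : D.Finite := (((hR.prod hR).sdiff).image _).insert _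
    obtain ⟨η, hηD, hmin⟩ := Set.exists_min_image D id hD ⟨δ, Set.mem_insert _ _⟩
    refine ⟨η, ?_, hmin δ (Set.mem_insert _ _), fun b hb b' hb' hne ↦
      hmin _ (Set.mem_insert_of_mem _ ⟨(b, b'), ⟨⟨hb, hb'⟩, hne⟩, rfl⟩)⟩
    rcases hηD with rfl | ⟨q, hq, rfl⟩
    · exact hδ
    · exact norm_pos_iff.2 (sub_ne_zero.2 hq.2)
  refine ⟨η ^ n / (n + 1), by positivity, (hR.image fun b ↦ ℚ_[p]⟮b⟯).subset ?_⟩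
  rintro L ⟨_, hL, x, hxL, hx1, hxδ, hxn, hxf⟩
  have hxi : IsIntegral ℚ_[p] x := Algebra.IsIntegral.isIntegral x
  obtain ⟨b, hb, hxb⟩ := exists_aroots_norm_sub_lt_of_norm_coeff_sub_lt (by positivity)
    (minpoly.aeval ℚ_[p] x) (minpoly.monic hxi) hf (hfn.trans hxn.symm) hxf (IsAlgClosed.splits _)
  replace hb : b ∈ R := by simpa [R, mem_rootSet, mem_aroots] using hb
  have hxb : ‖x - b‖ < η := by
    rw [hxn, mul_div_cancel₀ _ (by positivity), Real.pow_rpow_inv_natCast hη.le hn.ne',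
      max_eq_right hx1, mul_one] at hxb
    exact hxb
  have hbn : Module.finrank ℚ_[p] ℚ_[p]⟮b⟯ = n := by
    refine le_antisymm ?_ (not_lt.1 fun h ↦ (hxδ b h).not_gt (hxb.trans_le hηδ))
    rw [adjoin.finrank (Algebra.IsIntegral.isIntegral b), ← hfn]
    exact natDegree_le_of_dvd (minpoly.dvd _ _ (mem_rootSet.1 hb).2) hf.ne_zero
  refine ⟨b, hb, eq_of_le_of_finrank_eq ?_ (hbn.trans hL.symm)⟩
  exact (adjoin_le_adjoin_of_norm_sub_lt hf.ne_zero hηR hb hxb).trans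
    ((adjoin_simple_le_iff).2 hxL)

theorem finite_setOf_finrank_eq (n : ℕ) :
    {L : IntermediateField ℚ_[p] (PadicAlgCl p) |
      FiniteDimensional ℚ_[p] L ∧ Module.finrank ℚ_[p] L = n}.Finite := by
  induction n using Nat.strong_induction_on with
  | _ n ih =>
  rcases n.eq_zero_or_pos with rfl | hn
  · convert Set.finite_empty
    refine Set.eq_empty_of_forall_notMem fun L ⟨_, hL⟩ ↦ ?_
    exact (Module.finrank_pos (R := ℚ_[p]) (M := L)).ne' hL
  have hS : {L : IntermediateField ℚ_[p] (PadicAlgCl p) |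
      FiniteDimensional ℚ_[p] L ∧ Module.finrank ℚ_[p] L < n}.Finite := by
    refine ((Set.finite_Iio n).biUnion fun m hm ↦ ih m hm).subset fun L ⟨h, hL⟩ ↦ ?_
    exact Set.mem_biUnion hL ⟨h, rfl⟩
  obtain ⟨δ, hδ, H⟩ := exists_pos_forall_exists_le_norm_sub n hS fun _ h ↦ h
  let T (V : Set (Fin n → ℚ_[p])) : Set (IntermediateField ℚ_[p] (PadicAlgCl p)) :=
    {L | FiniteDimensional ℚ_[p] L ∧ Module.finrank ℚ_[p] L = n ∧ ∃ x ∈ L, ‖x‖ ≤ 1 ∧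
      (∀ b : PadicAlgCl p, Module.finrank ℚ_[p] ℚ_[p]⟮b⟯ < n → δ ≤ ‖x - b‖) ∧
      (minpoly ℚ_[p] x).natDegree = n ∧ (fun i : Fin n ↦ (minpoly ℚ_[p] x).coeff i) ∈ V}
  have hT : (T (Metric.closedBall 0 1)).Finite := by
    refine (isCompact_closedBall (0 : Fin n → ℚ_[p]) 1).induction_on (p := fun V ↦ (T V).Finite)
      ?_ ?_ ?_ ?_
    · simp [T]
    · intro V W hVW hW
      refine hW.subset ?_
      rintro L ⟨h, hL, x, hxL, hx1, hxδ, hxn, hx⟩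
      exact ⟨h, hL, x, hxL, hx1, hxδ, hxn, hVW hx⟩
    · intro V W hV hW
      refine (hV.union hW).subset ?_
      rintro L ⟨h, hL, x, hxL, hx1, hxδ, hxn, hx | hx⟩
      · exact .inl ⟨h, hL, x, hxL, hx1, hxδ, hxn, hx⟩
      · exact .inr ⟨h, hL, x, hxL, hx1, hxδ, hxn, hx⟩
    · intro v _
      let f : ℚ_[p][X] := X ^ n + ∑ i : Fin n, C (v i) * X ^ (i : ℕ)
      have hdeg : (∑ i : Fin n, C (v i) * X ^ (i : ℕ)).degree < (n : WithBot ℕ) :=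
        degree_sum_fin_lt v
      have hf : f.Monic := monic_X_pow_add hdeg
      have hfn : f.natDegree = n := by
        rw [natDegree_add_eq_left_of_degree_lt (by rwa [degree_X_pow]), natDegree_X_pow]
      have hfc (i : Fin n) : f.coeff i = v i := by
        simp [f, coeff_X_pow, i.2.ne, Fin.val_inj]
      obtain ⟨ε, hε, hfin⟩ := exists_pos_finite_of_norm_coeff_sub_lt hn hδ hf hfn
      refine ⟨_, mem_nhdsWithin_of_mem_nhds (Metric.ball_mem_nhds v hε), hfin.subset ?_⟩
      rintro L ⟨h, hL, x, hxL, hx1, hxδ, hxn, hx⟩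
      refine ⟨h, hL, x, hxL, hx1, hxδ, hxn, fun i ↦ ?_⟩
      have hmon := minpoly.monic (Algebra.IsIntegral.isIntegral (R := ℚ_[p]) x)
      rcases lt_trichotomy i n with hi | rfl | hi
      · rw [hfc ⟨i, hi⟩, ← dist_eq_norm, dist_comm]
        exact (dist_le_pi_dist _ v ⟨i, hi⟩).trans_lt hx
      · nth_rw 1 [← hfn]
        rw [hf.coeff_natDegree, ← hxn, hmon.coeff_natDegree]
        simpa
      · rw [coeff_eq_zero_of_natDegree_lt (hfn.trans_lt hi),
          coeff_eq_zero_of_natDegree_lt (hxn.trans_lt hi)]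
        simpa
  refine hT.subset ?_
  rintro L ⟨h, hL⟩
  obtain ⟨x, hxL, hx1, hx⟩ := H L h hL
  have hb (b : PadicAlgCl p) (hb : Module.finrank ℚ_[p] ℚ_[p]⟮b⟯ < n) : δ ≤ ‖x - b‖ :=
    hx ℚ_[p]⟮b⟯ ⟨adjoin.finiteDimensional (Algebra.IsIntegral.isIntegral b), hb⟩ b
      (mem_adjoin_simple_self _ b)
  refine ⟨h, hL, x, hxL, hx1, hb, ?_, ?_⟩
  · have hxi : IsIntegral ℚ_[p] x := Algebra.IsIntegral.isIntegral x
    rw [← adjoin.finrank hxi]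
    refine le_antisymm ?_ (not_lt.1 fun hlt ↦ ?_)
    · rw [← hL]
      exact finrank_le_of_le_right ((adjoin_simple_le_iff).2 hxL)
    · have := hb x hlt
      rw [sub_self, norm_zero] at this
      exact this.not_gt hδ
  · rw [mem_closedBall_zero_iff, pi_norm_le_iff_of_nonneg zero_le_one]
    exact fun i ↦ (norm_le_one_iff_norm_coeff_minpoly_le_one x).1 hx1 i

theorem finite_setOf_finrank_le (k : ℕ) :
    {L : IntermediateField ℚ_[p] (PadicAlgCl p) |
      FiniteDimensional ℚ_[p] L ∧ Module.finrank ℚ_[p] L ≤ k}.Finite := by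
  refine ((Set.finite_Iic k).biUnion fun m _ ↦ finite_setOf_finrank_eq (p := p) m).subset
    fun L ⟨h, hL⟩ ↦ ?_
  exact Set.mem_biUnion hL ⟨h, rfl⟩

end PadicAlgCl

/-- Let `K` be a nonarchimedean local field of characteristic `0`,
i.e. a finite extension of `ℚ_p` for some prime `p`, let `Ω` be an algebraic closure of `K`,
and let `k : ℕ`.  Then the set of intermediate fields `K ⊆ L ⊆ Ω` with `[L : K] ≤ k`
is finite.  (In particular `K` has only finitely many totally ramified extensions of degree
`≤ k` inside `Ω`.) -/
theorem stmt2 (p : ℕ) [Fact p.Prime] (K Ω : Type) [Field K] [Field Ω]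
    [Algebra ℚ_[p] K] [FiniteDimensional ℚ_[p] K]
    [Algebra K Ω] [IsAlgClosure K Ω] (k : ℕ) :
    {L : IntermediateField K Ω | FiniteDimensional K L ∧ Module.finrank K L ≤ k}.Finite := by
  let _ : Algebra ℚ_[p] Ω := ((algebraMap K Ω).comp (algebraMap ℚ_[p] K)).toAlgebra
  have : IsScalarTower ℚ_[p] K Ω := .of_algebraMap_eq fun _ ↦ rfl
  have : IsAlgClosed Ω := IsAlgClosure.isAlgClosed K
  have : Algebra.IsAlgebraic K Ω := IsAlgClosure.isAlgebraic
  have : Algebra.IsAlgebraic ℚ_[p] Ω := Algebra.IsAlgebraic.trans ℚ_[p] K Ω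
  have : IsAlgClosure ℚ_[p] Ω := ⟨inferInstance, inferInstance⟩
  let e : Ω ≃ₐ[ℚ_[p]] PadicAlgCl p := IsAlgClosure.equiv ℚ_[p] Ω (PadicAlgCl p)
  refine Set.Finite.of_injOn (f := fun L ↦ (L.restrictScalars ℚ_[p]).map e.toAlgHom) ?_
    (((IntermediateField.map_injective _).comp (restrictScalars_injective _)).injOn)
    (PadicAlgCl.finite_setOf_finrank_le (p := p) (Module.finrank ℚ_[p] K * k))
  rintro L ⟨_, hL⟩
  have : FiniteDimensional ℚ_[p] L := FiniteDimensional.trans ℚ_[p] K L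
  let φ : L.restrictScalars ℚ_[p] ≃ₐ[ℚ_[p]] (L.restrictScalars ℚ_[p]).map e.toAlgHom :=
    equivMap _ _
  have hfd : FiniteDimensional ℚ_[p] (L.restrictScalars ℚ_[p]) := this
  refine ⟨φ.toLinearEquiv.finiteDimensional, ?_⟩
  rw [← φ.toLinearEquiv.finrank_eq]
  change Module.finrank ℚ_[p] L ≤ _
  rw [← Module.finrank_mul_finrank ℚ_[p] K L]
  exact Nat.mul_le_mul_left _ hL
end

section
/- Let R be a commutative ring in which 2 = 0, and let g be a 3×3 matrix over R (rows and columns indexed by {1,2,3}) with det(g) = 1 and ^S g · E · g = E, where E is the diagonal matrix diag(1,0,1) and (^S g)_{i,j} = g_{4−j,4−i}. Then g₁₂ = 0, g₃₂ = 0, and g₂₂ = 1. -/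
/-- The antidiagonal transpose of a `3 × 3` matrix: `(ˢg)ᵢⱼ = g_{4-j,4-i}` (indices written
`1,2,3`; with `Fin 3` indices `0,1,2` this is `g j.rev i.rev`). -/
def antitranspose {R : Type*} (g : Matrix (Fin 3) (Fin 3) R) : Matrix (Fin 3) (Fin 3) R :=
  Matrix.of fun i j => g j.rev i.rev

/-- Let `R` be a commutative ring in which `2 = 0`, and let `g` be a
`3 × 3` matrix over `R` with `det g = 1` and `ˢg · E · g = E`, where `E = diag (1,0,1)`.
Then `g₁₂ = 0`, `g₃₂ = 0` and `g₂₂ = 1` (in `Fin 3` indexing: `g 0 1 = 0`, `g 2 1 = 0`,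
`g 1 1 = 1`). -/
theorem stmt12 (R : Type) [CommRing R] (h2 : (2 : R) = 0)
    (g : Matrix (Fin 3) (Fin 3) R) (hdet : g.det = 1)
    (hiso : antitranspose g * Matrix.diagonal ![1, 0, 1] * g = Matrix.diagonal ![1, 0, 1]) :
    g 0 1 = 0 ∧ g 2 1 = 0 ∧ g 1 1 = 1 := by
  have entry (i j : Fin 3) := congrFun (congrFun hiso i) j
  have h00 := entry 0 0
  have h10 := entry 1 0
  have h12 := entry 1 2
  simp [antitranspose, Matrix.mul_apply, Fin.sum_univ_three, Matrix.diagonal] at h00 h10 h12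
  have hx : g 0 1 = 0 := by
    linear_combination (-g 0 1) * h00 + g 0 2 * h10 + g 0 0 * h12 - g 0 0 * g 0 2 * g 2 1 * h2
  have hy : g 2 1 = 0 := by
    linear_combination (-g 2 1) * h00 + g 2 2 * h10 + g 2 0 * h12 - g 2 0 * g 2 2 * g 0 1 * h2
  refine ⟨hx, hy, ?_⟩
  rw [Matrix.det_fin_three, hx, hy] at hdet
  linear_combination hdet - g 1 1 * h00 + g 1 1 * g 0 2 * g 2 0 * h2
end
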